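/- Let (f_μ)_{μ∈ℝ} be a family of C^1 maps of ℝ, continuous in the strong C^1 topology at every parameter, and let p ∈ ℝ be such that for every μ, f_μ(p) = p and |f_μ'(p)| > 1. Let a(μ) = inf W^u_{f_μ}(p) and b(μ) = sup W^u_{f_μ}(p), regarded as functions of μ with values in the extended reals [−∞, +∞]. Suppose that both a and b are continuous at μ₀ and that f_{μ₀} has no homoclinic orbit associated to p. Then there exists δ > 0 such that for every μ with |μ − μ₀| < δ, the map f_μ has no homoclinic orbit associated to p. -/

import Mathlib

open Filter Set Topology

/-- The unstable set of `p`: the points having a preorbit that converges to `p`. -/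
def unstableSet (g : ℝ → ℝ) (p : ℝ) : Set ℝ :=
  {y | ∃ s : ℕ → ℝ, s 0 = y ∧ (∀ n : ℕ, g (s (n + 1)) = s n) ∧ Tendsto s atTop (nhds p)}

lemma mapsTo_unstableSet (g : ℝ → ℝ) (p : ℝ) :
    MapsTo g (unstableSet g p) (unstableSet g p) := by
  rintro y ⟨s, rfl, hs, hlim⟩
  refine ⟨fun n => g (s n), rfl, fun n => congrArg g (hs n), ?_⟩
  refine (tendsto_add_atTop_iff_nat 1).1 ?_
  simpa only [hs] using hlim

lemma surjOn_unstableSet (g : ℝ → ℝ) (p : ℝ) :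
    SurjOn g (unstableSet g p) (unstableSet g p) := by
  rintro y ⟨s, rfl, hs, hlim⟩
  exact ⟨s 1, ⟨fun n => s (n + 1), rfl, fun n => hs (n + 1),
    (tendsto_add_atTop_iff_nat 1).2 hlim⟩, hs 0⟩

lemma uIcc_subset_unstableSet {g : ℝ → ℝ} {p y : ℝ} (hg : Continuous g) (hp : g p = p)
    (hy : y ∈ unstableSet g p) : uIcc p y ⊆ unstableSet g p := by
  obtain ⟨s, rfl, hs, hlim⟩ := hy
  intro z hz
  have pull : ∀ n : ℕ, ∀ w ∈ uIcc p (s n), ∃ v ∈ uIcc p (s (n + 1)), g v = w := by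
    intro n w hw
    have h := intermediate_value_uIcc (a := p) (b := s (n + 1)) (f := g) hg.continuousOn
    rw [hp, hs n] at h
    exact h hw
  choose! v hv hgv using pull
  let t : ℕ → ℝ := fun n => Nat.rec z (fun k w => v k w) n
  have ht : ∀ n, t n ∈ uIcc p (s n) := by
    intro n
    induction n with
    | zero => exact hz
    | succ k ih => exact hv k _ ih
  refine ⟨t, rfl, fun n => hgv n _ (ht n), ?_⟩
  rw [tendsto_iff_dist_tendsto_zero] at hlim ⊢
  refine squeeze_zero (fun _ => dist_nonneg) (fun n => ?_) hlim
  rw [Real.dist_eq, Real.dist_eq, abs_sub_comm, abs_sub_comm (s n)]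
  simpa only [abs_sub_comm] using abs_sub_left_of_mem_uIcc (ht n)

lemma ordConnected_unstableSet {g : ℝ → ℝ} {p : ℝ} (hg : Continuous g) (hp : g p = p) :
    (unstableSet g p).OrdConnected := by
  refine ⟨fun x hx y hy z hz => ?_⟩
  rcases le_total p z with h | h
  · exact uIcc_subset_unstableSet hg hp hy (mem_uIcc_of_le h hz.2)
  · exact uIcc_subset_unstableSet hg hp hx (mem_uIcc_of_ge hz.1 h)

lemma eventually_abs_sub_le_of_one_lt_abs_deriv {g : ℝ → ℝ} {p : ℝ}
    (hp : g p = p) (hd : 1 < |deriv g p|) : ∀ᶠ x in 𝓝 p, |x - p| ≤ |g x - p| := by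
  have hdiff : DifferentiableAt ℝ g p := by
    by_contra h
    rw [deriv_zero_of_not_differentiableAt h, abs_zero] at hd
    linarith
  have h := (hasDerivAt_iff_tendsto_slope.1 hdiff.hasDerivAt).abs.eventually (lt_mem_nhds hd)
  rw [eventually_nhdsWithin_iff] at h
  filter_upwards [h] with x hx
  by_cases hxp : x = p
  · simp [hxp]
  · have h1 := hx hxp
    rw [slope_def_field, hp, abs_div, one_lt_div (abs_pos.2 (sub_ne_zero.2 hxp))] at h1
    exact h1.le

/-- A repelling fixed point has a homoclinic orbit exactly when it has a preimage, other than
itself, in its unstable set. -/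
lemma exists_homoclinic_iff {g : ℝ → ℝ} {p : ℝ} (hp : g p = p) (hd : 1 < |deriv g p|) :
    (∃ x : ℤ → ℝ, (∀ n : ℤ, g (x (n + 1)) = x n) ∧
      Tendsto x atTop (nhds p) ∧ Tendsto x atBot (nhds p) ∧ ∃ N : ℤ, x N ≠ p) ↔
    ∃ y ∈ unstableSet g p, y ≠ p ∧ g y = p := by
  constructor
  · rintro ⟨x, hx, htop, hbot, N, hN⟩
    obtain ⟨M, hM⟩ := eventually_atBot.1
      (hbot.eventually (eventually_abs_sub_le_of_one_lt_abs_deriv hp hd))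
    have hpM : ∀ m ≤ M, x m = p := by
      intro m hm
      have hmono : Monotone fun k : ℕ => |x (m - k) - p| := by
        refine monotone_nat_of_le_succ fun k => ?_
        have h := hM (m - k) (by omega)
        have h2 := hx (m - k - 1)
        rw [sub_add_cancel] at h2
        rw [h2] at h
        push_cast
        rwa [← sub_sub]
      have hlim : Tendsto (fun k : ℕ => |x (m - k) - p|) atTop (𝓝 0) := by
        have h1 : Tendsto (fun k : ℕ => m - (k : ℤ)) atTop atBot :=
          tendsto_atBot.2 fun c => (eventually_ge_atTop (m - c).toNat).mono fun k hk => by omega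
        simpa using ((hbot.comp h1).sub_const p).abs
      have h0 := hmono.ge_of_tendsto hlim 0
      simp only [Nat.cast_zero, sub_zero] at h0
      exact sub_eq_zero.1 (abs_nonpos_iff.1 h0)
    obtain ⟨n, hn, hn1⟩ : ∃ n, x n = p ∧ x (n + 1) ≠ p := by
      by_contra! hall
      have hle : min M N ≤ N := min_le_right _ _
      exact hN (Int.leInduction (motive := fun k _ => x k = p) (hpM _ (min_le_left _ _))
        (fun k _ hk => hall k hk) N hle)
    refine ⟨x (n + 1), ⟨fun k => x (n + 1 + k), by simp, fun k => ?_, ?_⟩, hn1, (hx n).trans hn⟩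
    · simpa [add_assoc] using hx (n + 1 + k)
    · exact htop.comp (tendsto_atTop_add_const_left _ _ tendsto_natCast_atTop_atTop)
  · rintro ⟨y, ⟨s, rfl, hs, hlim⟩, hne, hy⟩
    refine ⟨fun n => if n < 0 then p else s n.toNat, fun n => ?_, ?_, ?_, 0, by simpa using hne⟩
    · rcases lt_trichotomy n (-1) with h | rfl | h
      · simp only [if_pos (show n + 1 < 0 by omega), if_pos (show n < 0 by omega), hp]
      · simpa using hy
      · simp only [if_neg (show ¬ n + 1 < 0 by omega), if_neg (show ¬ n < 0 by omega)]
        rw [show (n + 1).toNat = n.toNat + 1 by omega, hs]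
    · have h1 : Tendsto Int.toNat atTop atTop :=
        tendsto_atTop.2 fun c => (eventually_ge_atTop (c : ℤ)).mono fun k hk => by omega
      refine (hlim.comp h1).congr' ?_
      filter_upwards [eventually_ge_atTop 0] with n hn
      simp [not_lt.2 hn]
    · refine tendsto_const_nhds.congr' ?_
      filter_upwards [eventually_lt_atBot 0] with n hn
      simp [hn]

/-- If `g` maps each of the disjoint sets `R`, `L` into `R` or into `L`, and covers their union,
then `g ∘ g` maps `R` onto itself. -/
lemma image_comp_self_eq_of_two_sides {α : Type*} {g : α → α} {R L : Set α} (hRL : Disjoint R L)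
    (hR : MapsTo g R R ∨ MapsTo g R L) (hL : MapsTo g L L ∨ MapsTo g L R)
    (hsurj : SurjOn g (R ∪ L) (R ∪ L)) : (g ∘ g) '' R = R := by
  have hd : ∀ z, z ∈ R → z ∈ L → False := fun z h1 h2 => disjoint_left.1 hRL h1 h2
  have hs : ∀ z, z ∈ R ∨ z ∈ L → ∃ w, (w ∈ R ∨ w ∈ L) ∧ g w = z := fun z hz => hsurj hz
  simp only [MapsTo] at hR hL
  ext z
  simp only [mem_image, Function.comp_apply]
  constructor
  · rintro ⟨w, hw, rfl⟩
    obtain ⟨u, hu, rfl⟩ := hs w (Or.inl hw)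
    grind
  · intro hz
    obtain ⟨w, hw, rfl⟩ := hs z (Or.inl hz)
    obtain ⟨u, hu, rfl⟩ := hs w hw
    obtain ⟨t, ht, rfl⟩ := hs u hu
    refine ⟨_, ?_, rfl⟩
    grind

lemma Set.OrdConnected.mapsTo_Ioi_or_mapsTo_Iio {g : ℝ → ℝ} {p : ℝ} {R : Set ℝ}
    (hR : R.OrdConnected) (hg : Continuous g) (hne : ∀ x ∈ R, g x ≠ p) :
    MapsTo g R (Ioi p) ∨ MapsTo g R (Iio p) := by
  by_contra! h
  simp only [MapsTo, not_forall, mem_Ioi, mem_Iio, not_lt] at h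
  obtain ⟨⟨u, hu, hup⟩, v, hv, hvp⟩ := h
  obtain ⟨w, hw, hwp⟩ :=
    hR.isPreconnected.intermediate_value hu hv hg.continuousOn ⟨hup, hvp⟩
  exact hne w hw hwp

lemma image_comp_self_sides {g : ℝ → ℝ} {p : ℝ} (hg : Continuous g) (hp : g p = p)
    (hno : ∀ y ∈ unstableSet g p, y ≠ p → g y ≠ p) :
    (g ∘ g) '' (unstableSet g p ∩ Ioi p) = unstableSet g p ∩ Ioi p ∧
    (g ∘ g) '' (unstableSet g p ∩ Iio p) = unstableSet g p ∩ Iio p := by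
  have hW := ordConnected_unstableSet hg hp
  have hmap := mapsTo_unstableSet g p
  have hd : Disjoint (unstableSet g p ∩ Ioi p) (unstableSet g p ∩ Iio p) :=
    disjoint_left.2 fun x h1 h2 => lt_asymm (mem_Ioi.1 h1.2) h2.2
  have hR := OrdConnected.mapsTo_Ioi_or_mapsTo_Iio (hW.inter ordConnected_Ioi) hg
    fun x (hx : x ∈ unstableSet g p ∩ Ioi p) => hno x hx.1 (ne_of_gt hx.2)
  have hL := OrdConnected.mapsTo_Ioi_or_mapsTo_Iio (hW.inter ordConnected_Iio) hg
    fun x (hx : x ∈ unstableSet g p ∩ Iio p) => hno x hx.1 (ne_of_lt hx.2)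
  replace hR := hR.imp (fun h => (hmap.mono_left inter_subset_left).inter h)
    (fun h => (hmap.mono_left inter_subset_left).inter h)
  replace hL := hL.imp (fun h => (hmap.mono_left inter_subset_left).inter h)
    (fun h => (hmap.mono_left inter_subset_left).inter h)
  have hs : SurjOn g (unstableSet g p ∩ Ioi p ∪ unstableSet g p ∩ Iio p)
      (unstableSet g p ∩ Ioi p ∪ unstableSet g p ∩ Iio p) := by
    have hmem : ∀ z, z ∈ unstableSet g p ∩ Ioi p ∪ unstableSet g p ∩ Iio p ↔
        z ∈ unstableSet g p ∧ z ≠ p := by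
      intro z
      rw [← inter_union_distrib_left, Ioi_union_Iio]
      rfl
    intro z hz
    rw [hmem] at hz
    obtain ⟨w, hw, rfl⟩ := surjOn_unstableSet g p hz.1
    refine ⟨w, (hmem w).2 ⟨hw, ?_⟩, rfl⟩
    rintro rfl
    exact hz.2 hp
  exact ⟨image_comp_self_eq_of_two_sides hd hR hL.symm hs,
    image_comp_self_eq_of_two_sides hd.symm hL.symm hR (by rwa [union_comm])⟩

/-- A point that compactifies an invariant side `A` of the fixed point `p` is not sent to `p`. -/
lemma ne_of_isCompact_insert {g : ℝ → ℝ} {p y : ℝ} {A : Set ℝ} (hg : Continuous g) (hp : g p = p)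
    (himg : (g ∘ g) '' A = A) (hc : IsCompact (insert y (insert p A)))
    (hcl : y ∈ closure A) (hyp : y ≠ p) (hyA : y ∉ A) : g y ≠ p := by
  intro hy
  have h1 : (g ∘ g) '' insert y (insert p A) = insert p A := by
    rw [image_insert_eq, image_insert_eq, himg]
    simp [hy, hp]
  have h2 : IsClosed (insert p A) := h1 ▸ (hc.image (hg.comp hg)).isClosed
  have h3 := h2.closure_subset (closure_mono (subset_insert p A) hcl)
  exact h3.elim hyp hyA

lemma sSup_lt_of_preimage {g : ℝ → ℝ} {p y : ℝ} (hg : Continuous g) (hp : g p = p)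
    (hno : ∀ y ∈ unstableSet g p, y ≠ p → g y ≠ p) (hpy : p < y) (hy : g y = p) :
    sSup ((fun x : ℝ => (x : EReal)) '' unstableSet g p) < y := by
  by_contra! hle
  have hyW : y ∉ unstableSet g p := fun h => hno y h hpy.ne' hy
  have hA : unstableSet g p ∩ Ioi p = Ioo p y := by
    ext z
    constructor
    · rintro ⟨hz, hpz⟩
      refine ⟨hpz, lt_of_not_ge fun h => hyW ?_⟩
      exact uIcc_subset_unstableSet hg hp hz (mem_uIcc_of_le hpy.le h)
    · rintro ⟨hpz, hzy⟩
      obtain ⟨_, ⟨w, hw, rfl⟩, hzw⟩ := lt_sSup_iff.1 ((EReal.coe_lt_coe_iff.2 hzy).trans_le hle)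
      exact ⟨uIcc_subset_unstableSet hg hp hw
        (mem_uIcc_of_le hpz.le (EReal.coe_lt_coe_iff.1 hzw).le), hpz⟩
  have himg := (image_comp_self_sides hg hp hno).1
  rw [hA] at himg
  refine ne_of_isCompact_insert hg hp himg ?_ ?_ hpy.ne' (by simp) hy
  · rw [Ioo_insert_left hpy, Ico_insert_right hpy.le]
    exact isCompact_Icc
  · rw [closure_Ioo hpy.ne]
    exact right_mem_Icc.2 hpy.le

lemma lt_sInf_of_preimage {g : ℝ → ℝ} {p y : ℝ} (hg : Continuous g) (hp : g p = p)
    (hno : ∀ y ∈ unstableSet g p, y ≠ p → g y ≠ p) (hpy : y < p) (hy : g y = p) :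
    y < sInf ((fun x : ℝ => (x : EReal)) '' unstableSet g p) := by
  by_contra! hle
  have hyW : y ∉ unstableSet g p := fun h => hno y h hpy.ne hy
  have hA : unstableSet g p ∩ Iio p = Ioo y p := by
    ext z
    constructor
    · rintro ⟨hz, hpz⟩
      refine ⟨lt_of_not_ge fun h => hyW ?_, hpz⟩
      exact uIcc_subset_unstableSet hg hp hz (mem_uIcc_of_ge h hpy.le)
    · rintro ⟨hzy, hpz⟩
      obtain ⟨_, ⟨w, hw, rfl⟩, hzw⟩ := sInf_lt_iff.1 (hle.trans_lt (EReal.coe_lt_coe_iff.2 hzy))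
      exact ⟨uIcc_subset_unstableSet hg hp hw
        (mem_uIcc_of_ge (EReal.coe_lt_coe_iff.1 hzw).le hpz.le), hpz⟩
  have himg := (image_comp_self_sides hg hp hno).2
  rw [hA] at himg
  refine ne_of_isCompact_insert hg hp himg ?_ ?_ hpy.ne (by simp) hy
  · rw [Ioo_insert_right hpy, Ioc_insert_left hpy.le]
    exact isCompact_Icc
  · rw [closure_Ioo hpy.ne]
    exact left_mem_Icc.2 hpy.le

lemma exists_eventually_le_of_tendsto {ι : Type*} {l : Filter ι} {b : ι → EReal} {b₀ : EReal}
    (hb : Tendsto b l (𝓝 b₀)) {S : Set ℝ} (hS : IsClosed S) (hbdd : BddBelow S)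
    (hlt : ∀ x ∈ S, b₀ < x) : ∃ c : EReal, (∀ᶠ i in l, b i ≤ c) ∧ ∀ x ∈ S, c < x := by
  rcases S.eq_empty_or_nonempty with rfl | hne
  · exact ⟨⊤, by simp, by simp⟩
  · obtain ⟨c, hc1, hc2⟩ := exists_between (hlt _ (hS.csInf_mem hne hbdd))
    exact ⟨c, (hb.eventually (gt_mem_nhds hc1)).mono fun _ h => h.le,
      fun x hx => hc2.trans_le (EReal.coe_le_coe_iff.2 (csInf_le hbdd hx))⟩

lemma exists_eventually_ge_of_tendsto {ι : Type*} {l : Filter ι} {b : ι → EReal} {b₀ : EReal}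
    (hb : Tendsto b l (𝓝 b₀)) {S : Set ℝ} (hS : IsClosed S) (hbdd : BddAbove S)
    (hlt : ∀ x ∈ S, x < b₀) : ∃ c : EReal, (∀ᶠ i in l, c ≤ b i) ∧ ∀ x ∈ S, x < c := by
  rcases S.eq_empty_or_nonempty with rfl | hne
  · exact ⟨⊥, by simp, by simp⟩
  · obtain ⟨c, hc1, hc2⟩ := exists_between (hlt _ (hS.csSup_mem hne hbdd))
    exact ⟨c, (hb.eventually (lt_mem_nhds hc2)).mono fun _ h => h.le,
      fun x hx => (EReal.coe_le_coe_iff.2 (le_csSup hbdd hx)).trans_lt hc1⟩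

/-- A strongly small perturbation of a continuous map does not create solutions of `g x = p` in a
closed set without such solutions. -/
lemma exists_strong_nhd_forall_ne {g : ℝ → ℝ} {p : ℝ} (hg : Continuous g) {D : Set ℝ}
    (hD : IsClosed D) (hne : ∀ x ∈ D, g x ≠ p) :
    ∃ ε : ℝ → ℝ, Continuous ε ∧ (∀ x, 0 < ε x) ∧
      ∀ h : ℝ → ℝ, (∀ x, |h x - g x| < ε x) → ∀ x ∈ D, h x ≠ p := by
  rcases D.eq_empty_or_nonempty with rfl | hDne
  · exact ⟨fun _ => 1, continuous_const, fun _ => one_pos, by simp⟩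
  refine ⟨fun x => |g x - p| + Metric.infDist x D,
    (hg.sub continuous_const).abs.add (Metric.continuous_infDist_pt D), fun x => ?_, ?_⟩
  · by_cases hx : x ∈ D
    · exact add_pos_of_pos_of_nonneg (abs_pos.2 (sub_ne_zero.2 (hne x hx))) Metric.infDist_nonneg
    · exact add_pos_of_nonneg_of_pos (abs_nonneg _) ((hD.notMem_iff_infDist_pos hDne).1 hx)
  · intro h hh x hx hxp
    have h1 : |h x - g x| < |g x - p| + Metric.infDist x D := hh x
    rw [Metric.infDist_zero_of_mem hx, add_zero, hxp, abs_sub_comm] at h1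
    exact lt_irrefl _ h1

/-- Let `(f_μ)` be a family of `C¹` maps of `ℝ`, continuous in
the strong `C¹` topology, all having `p` as a repellor fixed point. If the
endpoints `a(μ) = inf W^u_{f_μ}(p)` and `b(μ) = sup W^u_{f_μ}(p)` (as extended
reals) are continuous at `μ₀` and `f_{μ₀}` has no homoclinic orbit associated to
`p`, then no `f_μ` with `μ` close enough to `μ₀` has a homoclinic orbit
associated to `p`. -/
theorem continuity_of_unstable_set_no_homoclinic_is_open
    (f : ℝ → ℝ → ℝ)
    (hC1 : ∀ μ : ℝ, ContDiff ℝ 1 (f μ))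
    (hcont : ∀ μ₁ : ℝ, ∀ ε : ℝ → ℝ, Continuous ε → (∀ x, 0 < ε x) →
      ∃ δ > (0 : ℝ), ∀ μ : ℝ, |μ - μ₁| < δ → ∀ x : ℝ,
        |f μ x - f μ₁ x| < ε x ∧ |deriv (f μ) x - deriv (f μ₁) x| < ε x)
    (p : ℝ) (hfix : ∀ μ : ℝ, f μ p = p) (hrep : ∀ μ : ℝ, 1 < |deriv (f μ) p|)
    (W : ℝ → Set ℝ)
    (hW : ∀ μ : ℝ, W μ = {y | ∃ s : ℕ → ℝ, s 0 = y ∧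
      (∀ n : ℕ, f μ (s (n + 1)) = s n) ∧ Tendsto s atTop (nhds p)})
    (a b : ℝ → EReal)
    (ha : ∀ μ : ℝ, a μ = sInf ((fun x : ℝ => (x : EReal)) '' W μ))
    (hb : ∀ μ : ℝ, b μ = sSup ((fun x : ℝ => (x : EReal)) '' W μ))
    (μ₀ : ℝ) (hca : ContinuousAt a μ₀) (hcb : ContinuousAt b μ₀)
    (hnoh : ¬ ∃ x : ℤ → ℝ, (∀ n : ℤ, f μ₀ (x (n + 1)) = x n) ∧
      Tendsto x atTop (nhds p) ∧ Tendsto x atBot (nhds p) ∧ ∃ N : ℤ, x N ≠ p) :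
    ∃ δ > (0 : ℝ), ∀ μ : ℝ, |μ - μ₀| < δ →
      ¬ ∃ x : ℤ → ℝ, (∀ n : ℤ, f μ (x (n + 1)) = x n) ∧
        Tendsto x atTop (nhds p) ∧ Tendsto x atBot (nhds p) ∧
        ∃ N : ℤ, x N ≠ p := by
  have hW' : ∀ μ, W μ = unstableSet (f μ) p := hW
  have hg : Continuous (f μ₀) := (hC1 μ₀).continuous
  have hno : ∀ y ∈ unstableSet (f μ₀) p, y ≠ p → f μ₀ y ≠ p := fun y hy hne h =>
    hnoh ((exists_homoclinic_iff (hfix μ₀) (hrep μ₀)).2 ⟨y, hy, hne, h⟩)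
  obtain ⟨η, hη, hball⟩ : ∃ η > 0, ∀ x, |x - p| < η → 1 < |deriv (f μ₀) x| := by
    have h := ((hC1 μ₀).continuous_deriv le_rfl).abs.continuousAt.eventually
      (lt_mem_nhds (hrep μ₀))
    exact Metric.eventually_nhds_iff.1 h
  obtain ⟨b', hb1, hb2⟩ := exists_eventually_le_of_tendsto hcb
    (S := {x | p + η ≤ x ∧ f μ₀ x = p})
    (isClosed_Ici.inter (isClosed_singleton.preimage hg)) ⟨p + η, fun x hx => hx.1⟩
    (fun x hx => by
      rw [hb, hW']
      exact sSup_lt_of_preimage hg (hfix μ₀) hno (by linarith [hx.1]) hx.2)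
  obtain ⟨a', ha1, ha2⟩ := exists_eventually_ge_of_tendsto hca
    (S := {x | x ≤ p - η ∧ f μ₀ x = p})
    (isClosed_Iic.inter (isClosed_singleton.preimage hg)) ⟨p - η, fun x hx => hx.1⟩
    (fun x hx => by
      rw [ha, hW']
      exact lt_sInf_of_preimage hg (hfix μ₀) hno (by linarith [hx.1]) hx.2)
  have hD : IsClosed {x : ℝ | η ≤ |x - p| ∧ a' ≤ (x : EReal) ∧ (x : EReal) ≤ b'} :=
    (isClosed_le continuous_const (continuous_id.sub continuous_const).abs).inter
      ((isClosed_le continuous_const continuous_coe_real_ereal).inter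
        (isClosed_le continuous_coe_real_ereal continuous_const))
  obtain ⟨ε, hε, hε0, hεD⟩ := exists_strong_nhd_forall_ne (p := p) hg hD (by
    rintro x ⟨hx, hax, hxb⟩ hxp
    rcases le_abs.1 hx with h | h
    · exact (hb2 x ⟨by linarith, hxp⟩).not_ge hxb
    · exact (ha2 x ⟨by linarith, hxp⟩).not_ge hax)
  obtain ⟨δ₁, hδ₁, h1⟩ := hcont μ₀ ε hε hε0
  obtain ⟨δ₂, hδ₂, h2⟩ := hcont μ₀ (fun _ => 1) continuous_const fun _ => one_pos
  obtain ⟨δ₃, hδ₃, h3⟩ := Metric.eventually_nhds_iff.1 (ha1.and hb1)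
  refine ⟨min δ₁ (min δ₂ δ₃), by positivity, fun μ hμ => ?_⟩
  obtain ⟨hμ1, hμ2, hμ3⟩ : |μ - μ₀| < δ₁ ∧ |μ - μ₀| < δ₂ ∧ |μ - μ₀| < δ₃ := by
    simpa only [lt_min_iff] using hμ
  rw [exists_homoclinic_iff (hfix μ) (hrep μ)]
  rintro ⟨y, hy, hyp, hfy⟩
  obtain ⟨haμ, hbμ⟩ := h3 hμ3
  have hymem : (y : EReal) ∈ (fun x : ℝ => (x : EReal)) '' W μ :=
    mem_image_of_mem _ (by rwa [hW'])
  rcases le_or_gt η |y - p| with hfar | hnear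
  · refine hεD (f μ) (fun x => (h1 μ hμ1 x).1) y ⟨hfar, haμ.trans ?_, le_trans ?_ hbμ⟩ hfy
    · rw [ha]
      exact sInf_le hymem
    · rw [hb]
      exact le_sSup hymem
  · have hder : ∀ x, |x - p| < η → deriv (f μ) x ≠ 0 := by
      intro x hx h0
      have h4 := (h2 μ hμ2 x).2
      rw [h0, zero_sub, abs_neg] at h4
      exact lt_asymm h4 (hball x hx)
    rcases lt_or_gt_of_ne hyp with hlt | hlt
    · obtain ⟨c, hc, hc0⟩ := exists_deriv_eq_zero hlt (hC1 μ).continuous.continuousOn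
        (hfy.trans (hfix μ).symm)
      refine hder c ?_ hc0
      rw [abs_lt] at hnear ⊢
      constructor <;> linarith [hc.1, hc.2, hnear.1]
    · obtain ⟨c, hc, hc0⟩ := exists_deriv_eq_zero hlt (hC1 μ).continuous.continuousOn
        ((hfix μ).trans hfy.symm)
      refine hder c ?_ hc0
      rw [abs_lt] at hnear ⊢
      constructor <;> linarith [hc.1, hc.2, hnear.2]
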